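/- arXiv:2601.15620 — 6 statements merged into one kernel-verified Lean document; each statement's English description precedes it below -/
import Mathlib

section
/- Let K ≥ 2 and 1 ≤ j ≤ K be integers. Let σ be a uniformly random permutation of {1,…,K}, and for each b ∈ {1,…,⌈log₂ K⌉+1} define the bracket B_b = {σ(1),…,σ(min(2^{b−1},K))}. Let b_j = min{b ∈ {1,…,⌈log₂ K⌉+1} : B_b ∩ {1,…,j} ≠ ∅} (this minimum exists since B_{⌈log₂ K⌉+1} = {1,…,K}). Then for every b̃ ∈ {1,…,⌈log₂ K⌉+1}, Pr(b_j ≥ b̃) ≤ exp(−j·⌊2^{b̃−2}⌋/K), where ⌊2^{b̃−2}⌋ = 0 when b̃ = 1. -/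
open Finset in
/-- Forcing one more position into `T` costs a factor of at least `card α / #T`. -/
theorem Equiv.Perm.card_mul_card_filter_forall_mem_insert_le {α : Type*} [Fintype α]
    [DecidableEq α] (S T : Finset α) {a : α} (ha : a ∉ S) :
    Fintype.card α * #{σ : Equiv.Perm α | ∀ i ∈ insert a S, σ i ∈ T} ≤
      #T * #{σ : Equiv.Perm α | ∀ i ∈ S, σ i ∈ T} := by
  have key (p : α) : #{σ : Equiv.Perm α | ∀ i ∈ insert a S, σ i ∈ T} ≤
      #{σ ∈ {σ : Equiv.Perm α | ∀ i ∈ S, σ i ∈ T} | σ p ∈ T} := by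
    by_cases hp : p ∈ S
    · refine card_le_card fun σ hσ => ?_
      simp only [mem_filter, mem_univ, true_and, forall_mem_insert] at hσ ⊢
      exact ⟨hσ.2, hσ.2 p hp⟩
    · refine card_le_card_of_injOn (fun σ => σ * Equiv.swap a p) (fun σ hσ => ?_)
        (mul_left_injective _).injOn
      simp only [coe_filter, Set.mem_ofPred_eq, mem_filter, mem_univ, true_and,
        forall_mem_insert, Equiv.Perm.mul_apply, Equiv.swap_apply_right] at hσ ⊢
      refine ⟨fun i hi => ?_, hσ.1⟩
      rw [Equiv.swap_apply_of_ne_of_ne (ne_of_mem_of_not_mem hi ha) (ne_of_mem_of_not_mem hi hp)]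
      exact hσ.2 i hi
  have hT (σ : Equiv.Perm α) : #{p | σ p ∈ T} = #T := by
    rw [← card_map σ.toEmbedding]
    congr 1
    ext p
    simp [mem_map_equiv]
  calc Fintype.card α * #{σ : Equiv.Perm α | ∀ i ∈ insert a S, σ i ∈ T}
      = ∑ _p : α, #{σ : Equiv.Perm α | ∀ i ∈ insert a S, σ i ∈ T} := by simp
    _ ≤ ∑ p : α, #{σ ∈ {σ : Equiv.Perm α | ∀ i ∈ S, σ i ∈ T} | σ p ∈ T} :=
        sum_le_sum fun p _ => key p
    _ = ∑ σ : Equiv.Perm α with ∀ i ∈ S, σ i ∈ T, #{p | σ p ∈ T} :=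
        sum_card_bipartiteAbove_eq_sum_card_bipartiteBelow (fun p (σ : Equiv.Perm α) => σ p ∈ T)
    _ = #T * #{σ : Equiv.Perm α | ∀ i ∈ S, σ i ∈ T} := by
        simp only [hT, sum_const, smul_eq_mul, mul_comm]

open Finset in
/-- A uniformly random permutation maps all of `S` into `T` with probability at most
`(#T / card α) ^ #S`. -/
theorem Equiv.Perm.card_pow_mul_card_filter_forall_mem_le {α : Type*} [Fintype α]
    [DecidableEq α] (S T : Finset α) :
    Fintype.card α ^ #S * #{σ : Equiv.Perm α | ∀ i ∈ S, σ i ∈ T} ≤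
      #T ^ #S * Fintype.card (Equiv.Perm α) := by
  induction S using Finset.induction_on with
  | empty => simp
  | insert a S ha ih =>
    rw [card_insert_of_notMem ha, pow_succ, pow_succ, mul_assoc]
    calc _ ≤ Fintype.card α ^ #S * (#T * #{σ : Equiv.Perm α | ∀ i ∈ S, σ i ∈ T}) :=
          Nat.mul_le_mul_left _ (card_mul_card_filter_forall_mem_insert_le S T ha)
      _ = #T * (Fintype.card α ^ #S * #{σ : Equiv.Perm α | ∀ i ∈ S, σ i ∈ T}) := by ring
      _ ≤ #T * (#T ^ #S * Fintype.card (Equiv.Perm α)) := Nat.mul_le_mul_left _ ih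
      _ = _ := by ring

/-- Lemma: for a uniformly random permutation σ of the K arms (K ≥ 2), with brackets
`B_b = {σ(1),…,σ(min(2^(b-1),K))}` for `b ∈ {1,…,⌈log₂ K⌉+1}`, and
`b_j = min{b : B_b ∩ {1,…,j} ≠ ∅}`, we have
`Pr(b_j ≥ b̃) ≤ exp(−j⌊2^(b̃−2)⌋/K)`. Arms are modeled as `Fin K` (0-indexed), so the
set `{1,…,j}` of the first `j` arms is `{a : Fin K | (a : ℕ) < j}`, and position set
`{1,…,min(2^(b−1),K)}` is `{i : Fin K | (i : ℕ) < min (2^(b−1)) K}`. -/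
theorem stmt_0 (K j : ℕ) (hK : 2 ≤ K) (hj1 : 1 ≤ j) (hjK : j ≤ K)
    (B : Equiv.Perm (Fin K) → ℕ → Finset (Fin K))
    (hB : ∀ σ b, B σ b =
      (Finset.univ.filter (fun i : Fin K => (i : ℕ) < min (2 ^ (b - 1)) K)).image σ)
    (bj : Equiv.Perm (Fin K) → ℕ)
    (hbj : ∀ σ, bj σ = sInf {b | b ∈ Finset.Icc 1 (Nat.clog 2 K + 1) ∧
      (B σ b ∩ Finset.univ.filter (fun a : Fin K => (a : ℕ) < j)).Nonempty})
    (btilde : ℕ) (hb : btilde ∈ Finset.Icc 1 (Nat.clog 2 K + 1)) :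
    ((Finset.univ.filter (fun σ : Equiv.Perm (Fin K) => btilde ≤ bj σ)).card : ℝ) /
      (Fintype.card (Equiv.Perm (Fin K)) : ℝ) ≤
      Real.exp (-((j : ℝ) * (⌊(2 : ℝ) ^ ((btilde : ℤ) - 2)⌋₊ : ℝ) / K)) := by
  obtain ⟨hb1, hb2⟩ := Finset.mem_Icc.1 hb
  have hfact : (0 : ℝ) < (Fintype.card (Equiv.Perm (Fin K)) : ℝ) :=
    Nat.cast_pos.2 Fintype.card_pos
  have hK0 : (0 : ℝ) < K := by exact_mod_cast (by omega : 0 < K)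
  rw [div_le_iff₀ hfact]
  obtain rfl | ⟨t, rfl⟩ : btilde = 1 ∨ ∃ t, btilde = t + 2 := by
    rcases btilde with _ | _ | t
    · omega
    · exact Or.inl rfl
    · exact Or.inr ⟨t, rfl⟩
  · have hfloor : ⌊(2 : ℝ) ^ (((1 : ℕ) : ℤ) - 2)⌋₊ = 0 := by
      rw [Nat.floor_eq_zero]
      norm_num
    rw [hfloor]
    simpa using Finset.card_le_univ
      (Finset.univ.filter (fun σ : Equiv.Perm (Fin K) => 1 ≤ bj σ))
  have hfloor : ⌊(2 : ℝ) ^ (((t + 2 : ℕ) : ℤ) - 2)⌋₊ = 2 ^ t := by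
    have hexp : (((t + 2 : ℕ) : ℤ) - 2) = (t : ℤ) := by push_cast; ring
    rw [hexp, zpow_natCast]
    exact_mod_cast Nat.floor_natCast (R := ℝ) (2 ^ t)
  rw [hfloor]
  have htK : 2 ^ t < K := (Nat.lt_clog_iff_pow_lt (by norm_num)).1 (by omega)
  set S : Finset (Fin K) := Finset.univ.filter (fun i : Fin K => (i : ℕ) < 2 ^ t) with hS
  set T : Finset (Fin K) := Finset.univ.filter (fun a : Fin K => ¬ (a : ℕ) < j) with hT
  have hScard : S.card = 2 ^ t := by
    rw [hS, Fin.card_filter_val_lt, min_eq_right htK.le]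
  have hTcard : T.card = K - j := by
    have h := Finset.card_filter_add_card_filter_not (s := (Finset.univ : Finset (Fin K)))
      (fun a : Fin K => (a : ℕ) < j)
    rw [Fin.card_filter_val_lt, min_eq_right hjK, Finset.card_univ, Fintype.card_fin] at h
    rw [hT]
    omega
  have hsub : Finset.univ.filter (fun σ : Equiv.Perm (Fin K) => t + 2 ≤ bj σ) ⊆
      Finset.univ.filter (fun σ : Equiv.Perm (Fin K) => ∀ i ∈ S, σ i ∈ T) := by
    intro σ hσ
    simp only [Finset.mem_filter, Finset.mem_univ, true_and, hS, hT] at hσ ⊢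
    intro i hi hlt
    have hle : bj σ ≤ t + 1 := by
      rw [hbj]
      refine Nat.sInf_le ⟨Finset.mem_Icc.2 ⟨by omega, by omega⟩, σ i, ?_⟩
      simp only [hB, Finset.mem_inter, Finset.mem_filter, Finset.mem_univ, true_and]
      exact ⟨Finset.mem_image_of_mem σ (by simpa using hi), hlt⟩
    omega
  have hcount : K ^ 2 ^ t *
      (Finset.univ.filter (fun σ : Equiv.Perm (Fin K) => ∀ i ∈ S, σ i ∈ T)).card ≤
      (K - j) ^ 2 ^ t * Fintype.card (Equiv.Perm (Fin K)) := by
    convert Equiv.Perm.card_pow_mul_card_filter_forall_mem_le S T <;> simp [hScard, hTcard]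
  have hcountR : (K : ℝ) ^ 2 ^ t *
      ((Finset.univ.filter (fun σ : Equiv.Perm (Fin K) => t + 2 ≤ bj σ)).card : ℝ) ≤
      ((K : ℝ) - j) ^ 2 ^ t * (Fintype.card (Equiv.Perm (Fin K)) : ℝ) := by
    rw [← Nat.cast_sub hjK]
    exact_mod_cast (Nat.mul_le_mul_left (K ^ 2 ^ t) (Finset.card_le_card hsub)).trans hcount
  have hexp : ((K : ℝ) - j) ^ 2 ^ t ≤
      (K : ℝ) ^ 2 ^ t * Real.exp (-((j : ℝ) * ((2 ^ t : ℕ) : ℝ) / K)) := by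
    have hbase : (K : ℝ) - j ≤ K * Real.exp (-((j : ℝ) / K)) := by
      calc (K : ℝ) - j = K * (-((j : ℝ) / K) + 1) := by field_simp; ring
        _ ≤ _ := mul_le_mul_of_nonneg_left (Real.add_one_le_exp _) hK0.le
    have hnonneg : (0 : ℝ) ≤ (K : ℝ) - j := sub_nonneg.2 (by exact_mod_cast hjK)
    refine (pow_le_pow_left₀ hnonneg hbase _).trans_eq ?_
    rw [mul_pow, ← Real.exp_nat_mul]
    congr 2
    ring
  refine le_of_mul_le_mul_left (hcountR.trans ?_) (pow_pos hK0 (2 ^ t))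
  rw [← mul_assoc]
  exact mul_le_mul_of_nonneg_right hexp hfact.le
end

section
/- Let a, b, x be real numbers with b ≥ a ≥ 0 and b ≥ e². If x ≥ b + 2a·log(log b), then x ≥ a·log(log x) + b. -/
/-- The tangent line of `log` at `c` lies above its graph. -/
theorem log_le_log_add_sub_div {c y : ℝ} (hc : 0 < c) (hy : 0 < y) :
    Real.log y ≤ Real.log c + (y - c) / c := by
  have h := Real.log_le_sub_one_of_pos (div_pos hy hc)
  rw [Real.log_div hy.ne' hc.ne'] at h
  rw [sub_div, div_self hc.ne']
  linarith

/-- For reals `b ≥ a ≥ 0` with `b ≥ e²`: if `x ≥ b + 2a·log(log b)` then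
`x ≥ a·log(log x) + b`. -/
theorem stmt_4 (a b x : ℝ) (ha : 0 ≤ a) (hab : a ≤ b) (hb : Real.exp 2 ≤ b)
    (hx : b + 2 * a * Real.log (Real.log b) ≤ x) :
    a * Real.log (Real.log x) + b ≤ x := by
  have hb0 : 0 < b := (Real.exp_pos 2).trans_le hb
  have hL : 2 ≤ Real.log b := (Real.le_log_iff_exp_le hb0).2 hb
  set L := Real.log b with hLdef
  have hM0 : 0 ≤ Real.log L := Real.log_nonneg (by linarith)
  have hM1 : Real.log L ≤ L - 1 := Real.log_le_sub_one_of_pos (by linarith)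
  set c := b + 2 * a * Real.log L with hcdef
  have hbc : b ≤ c := le_add_of_nonneg_right (by positivity)
  have hc0 : 0 < c := hb0.trans_le hbc
  have hx0 : 0 < x := hc0.trans_le hx
  have hlogc : L ≤ Real.log c := Real.log_le_log hb0 hbc
  have hlogx : Real.log c ≤ Real.log x := Real.log_le_log hc0 hx
  have hc_sq : Real.log c ≤ L ^ 2 := by
    have h := log_le_log_add_sub_div hb0 hc0
    have h' : (c - b) / b ≤ 2 * Real.log L := by
      rw [div_le_iff₀ hb0]
      nlinarith [mul_le_mul_of_nonneg_right hab hM0]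
    nlinarith
  have hloglogc : Real.log (Real.log c) ≤ 2 * Real.log L := by
    have h := Real.log_le_log (by linarith) hc_sq
    rwa [Real.log_pow, Nat.cast_ofNat] at h
  have hloglogx : Real.log (Real.log x) ≤ Real.log (Real.log c) + (x - c) / c := by
    have h₁ := log_le_log_add_sub_div (show 0 < Real.log c by linarith)
      (show 0 < Real.log x by linarith)
    have h₂ := log_le_log_add_sub_div hc0 hx0
    have h₃ := div_le_self (sub_nonneg.2 hlogx) (show 1 ≤ Real.log c by linarith)
    linarith
  have hslope : a * ((x - c) / c) ≤ x - c := by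
    rw [mul_div_assoc', div_le_iff₀ hc0, mul_comm]
    exact mul_le_mul_of_nonneg_left (hab.trans hbc) (sub_nonneg.2 hx)
  nlinarith [mul_le_mul_of_nonneg_left hloglogx ha, mul_le_mul_of_nonneg_left hloglogc ha]
end

section
/- Let a, b, x be real numbers with a ≥ e and b > e. If e ≤ x ≤ b + a·log(log b), then x < a·log(log x) + b. -/
/-- For reals `a ≥ e` and `b > e`: if `e ≤ x ≤ b + a·log(log b)` then
`x < a·log(log x) + b`. -/
theorem stmt_5 (a b x : ℝ) (ha : Real.exp 1 ≤ a) (hb : Real.exp 1 < b)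
    (hx1 : Real.exp 1 ≤ x) (hx2 : x ≤ b + a * Real.log (Real.log b)) :
    x < a * Real.log (Real.log x) + b := by
  have ha0 : 0 < a := (Real.exp_pos 1).trans_le ha
  have hb0 : 0 < b := (Real.exp_pos 1).trans hb
  have hx0 : 0 < x := (Real.exp_pos 1).trans_le hx1
  have hlogb : 1 < Real.log b := (Real.lt_log_iff_exp_lt hb0).2 hb
  have hlogx : 1 ≤ Real.log x := (Real.le_log_iff_exp_le hx0).2 hx1
  rcases lt_trichotomy x b with h | rfl | h
  · linarith [mul_nonneg ha0.le (Real.log_nonneg hlogx)]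
  · linarith [mul_pos ha0 (Real.log_pos hlogb)]
  · have hloglog : Real.log (Real.log b) < Real.log (Real.log x) :=
      Real.log_lt_log (zero_lt_one.trans hlogb) (Real.log_lt_log hb0 h)
    linarith [mul_lt_mul_of_pos_left hloglog ha0]
end

section
/- Let Δ ∈ (0,1], let K ≥ 2 be an integer, let δ ∈ (0, 1/2], let C ≥ 1, and let t be a real number satisfying t > 28C²·log(2K/δ)/Δ² + 16C²·log(log(24C²/Δ²))/Δ². Then C·√( 4·log( 2K·(log₂(2t))² / δ ) / t ) < Δ. -/
/-- For `Δ ∈ (0,1]`, integer `K ≥ 2`, `δ ∈ (0,1/2]`, `C ≥ 1`, and real `t` with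
`t > 28C²log(2K/δ)/Δ² + 16C²log(log(24C²/Δ²))/Δ²`, we have
`C·√(4·log(2K(log₂(2t))²/δ)/t) < Δ`. -/
theorem stmt_6 (Δ : ℝ) (hΔ : Δ ∈ Set.Ioc (0 : ℝ) 1) (K : ℕ) (hK : 2 ≤ K)
    (δ : ℝ) (hδ : δ ∈ Set.Ioc (0 : ℝ) (1 / 2)) (C : ℝ) (hC : 1 ≤ C) (t : ℝ)
    (ht : 28 * C ^ 2 * Real.log (2 * K / δ) / Δ ^ 2
        + 16 * C ^ 2 * Real.log (Real.log (24 * C ^ 2 / Δ ^ 2)) / Δ ^ 2 < t) :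
    C * Real.sqrt (4 * Real.log (2 * K * (Real.logb 2 (2 * t)) ^ 2 / δ) / t) < Δ := by
  obtain ⟨hΔ0, hΔ1⟩ := hΔ
  obtain ⟨hδ0, hδ1⟩ := hδ
  have hK' : (2 : ℝ) ≤ K := by exact_mod_cast hK
  have he := Real.exp_one_lt_d9
  set L := Real.log (2 * K / δ) with hL
  set a := C ^ 2 / Δ ^ 2 with ha
  have hΔ2 : 0 < Δ ^ 2 := by positivity
  have ha1 : 1 ≤ a := by
    rw [ha, le_div_iff₀ hΔ2]
    nlinarith
  have ha0 : 0 < a := by linarith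
  have hKδ : 8 ≤ 2 * K / δ := by
    rw [le_div_iff₀ hδ0]
    linarith
  have hL1 : 1 ≤ L := by
    rw [hL, Real.le_log_iff_exp_le (by linarith)]
    linarith
  set x := Real.log (24 * a) with hx
  have hx2 : 2 ≤ x := by
    rw [hx, Real.le_log_iff_exp_le (by positivity)]
    have h : Real.exp 2 = Real.exp 1 * Real.exp 1 := by
      rw [← Real.exp_add]
      norm_num
    nlinarith [Real.exp_pos 1]
  have hx0 : 0 ≤ Real.log x := Real.log_nonneg (by linarith)
  obtain ⟨s, rfl⟩ : ∃ s, t = a * s := ⟨t / a, by field_simp⟩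
  have hs : 28 * L + 16 * Real.log x < s := by
    have h24 : 24 * C ^ 2 / Δ ^ 2 = 24 * a := by rw [ha]; ring
    rw [h24, ← hx] at ht
    refine lt_of_mul_lt_mul_left (lt_of_eq_of_lt ?_ ht) ha0.le
    rw [ha]
    ring
  have hs0 : 28 < s := by linarith
  set v := Real.log (s / 12) with hv
  have hv0 : 0 ≤ v := Real.log_nonneg (by linarith)
  have hv1 : v ≤ s / 12 - 1 := Real.log_le_sub_one_of_pos (by linarith)
  have hlog : Real.log (2 * (a * s)) = x + v := by
    rw [hx, hv, ← Real.log_mul (by positivity) (by positivity)]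
    ring_nf
  have hl2 := Real.log_two_gt_d9
  have hl2' := Real.log_two_lt_d9
  set y := Real.logb 2 (2 * (a * s)) with hy
  have hy' : y = (x + v) / Real.log 2 := by rw [hy, Real.logb, hlog]
  have hy0 : 0 < y := by
    rw [hy']
    exact div_pos (by linarith) (by linarith)
  have hyle : y ≤ 2 * (x * (1 + v / x)) := by
    have h : x * (1 + v / x) = x + v := by field_simp
    rw [h, hy', div_le_iff₀ (by linarith)]
    nlinarith
  have hvx0 : 0 ≤ v / x := by positivity
  have hvx : v / x ≤ v / 2 := div_le_div_of_nonneg_left hv0 (by norm_num) hx2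
  have hlogy : Real.log y ≤ 1 + Real.log x + v / 2 := by
    have h1 := Real.log_le_log hy0 hyle
    rw [Real.log_mul (by norm_num) (by positivity),
      Real.log_mul (by positivity) (by positivity)] at h1
    have h2 := Real.log_le_sub_one_of_pos (x := 1 + v / x) (by positivity)
    linarith
  have hsplit : Real.log (2 * K * y ^ 2 / δ) = L + 2 * Real.log y := by
    rw [mul_div_right_comm, Real.log_mul (by positivity) (by positivity), Real.log_pow]
    norm_num [hL]
  have hC0 : 0 < C := by linarith
  rw [hsplit, mul_comm, ← lt_div_iff₀ hC0, Real.sqrt_lt' (by positivity), div_lt_iff₀ (by positivity)]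
  have hcancel : (Δ / C) ^ 2 * (a * s) = s := by
    rw [ha]
    field_simp
  rw [hcancel]
  linarith
end

section
/- Let v > 0 and let X be a real random variable on a probability space (Ω, F, P) such that P(X > s) ≤ exp(−s²/(2v)) for every s > 0. Then for every measurable event E with P(E) > 0: E[ 1_E · max(X, 0) ] ≤ P(E)·√( 2v·log(1/P(E)) ) + P(E)·√(2πv). Consequently, E[ 1_E · X ] is bounded above by the same quantity whenever 1_E·X is integrable. -/
open MeasureTheory

/-- The positive part of a random variable with a Gaussian right tail of mass `p` has
integral at most `p * √(2πv)`. -/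
theorem integrable_and_integral_posPart_le_of_gaussian_tail {Ω : Type*} [MeasurableSpace Ω]
    {μ : Measure Ω} {v p : ℝ} (hv : 0 < v) (hp : 0 ≤ p) {Y : Ω → ℝ} (hY : Measurable Y)
    (htail : ∀ s : ℝ, 0 < s →
      μ {ω | s < Y ω} ≤ ENNReal.ofReal (p * Real.exp (-(1 / (2 * v)) * s ^ 2))) :
    Integrable (fun ω => max (Y ω) 0) μ ∧
      ∫ ω, max (Y ω) 0 ∂μ ≤ p * Real.sqrt (2 * Real.pi * v) := by
  have hb : 0 < 1 / (2 * v) := by positivity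
  have hmeas : Measurable fun ω => max (Y ω) 0 := hY.max measurable_const
  have hnn : 0 ≤ᵐ[μ] fun ω => max (Y ω) 0 := ae_of_all _ fun ω => le_max_right _ _
  have hint : IntegrableOn (fun s : ℝ => p * Real.exp (-(1 / (2 * v)) * s ^ 2)) (Set.Ioi 0) :=
    ((integrable_exp_neg_mul_sq hb).const_mul p).integrableOn
  have hgauss : ∫ s in Set.Ioi (0 : ℝ), p * Real.exp (-(1 / (2 * v)) * s ^ 2) =
      p * (Real.sqrt (2 * Real.pi * v) / 2) := by
    rw [integral_const_mul, integral_gaussian_Ioi]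
    congr 3
    field_simp
  have hle : ∫⁻ ω, ENNReal.ofReal (max (Y ω) 0) ∂μ ≤
      ENNReal.ofReal (p * Real.sqrt (2 * Real.pi * v)) := by
    rw [lintegral_eq_lintegral_meas_lt μ hnn hmeas.aemeasurable]
    calc ∫⁻ s in Set.Ioi (0 : ℝ), μ {ω | s < max (Y ω) 0}
        ≤ ∫⁻ s in Set.Ioi (0 : ℝ), ENNReal.ofReal (p * Real.exp (-(1 / (2 * v)) * s ^ 2)) := by
          refine setLIntegral_mono' measurableSet_Ioi fun s hs => ?_
          have hs' : 0 < s := hs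
          simpa [hs'.not_gt] using htail s hs'
      _ = ENNReal.ofReal (p * (Real.sqrt (2 * Real.pi * v) / 2)) := by
          rw [← hgauss, ofReal_integral_eq_lintegral_ofReal hint
            (ae_of_all _ fun s => by positivity)]
      _ ≤ ENNReal.ofReal (p * Real.sqrt (2 * Real.pi * v)) := by
          refine ENNReal.ofReal_le_ofReal (mul_le_mul_of_nonneg_left ?_ hp)
          exact half_le_self (Real.sqrt_nonneg _)
  refine ⟨⟨hmeas.aestronglyMeasurable, ?_⟩, ?_⟩
  · rw [hasFiniteIntegral_iff_ofReal hnn]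
    exact hle.trans_lt ENNReal.ofReal_lt_top
  · rw [integral_eq_lintegral_of_nonneg_ae hnn hmeas.aestronglyMeasurable]
    exact ENNReal.toReal_le_of_le_ofReal (by positivity) hle

/-- A Gaussian tail bound at `t + s` factors when `t` is chosen so that the bound at `t` is `p`. -/
theorem exp_neg_sq_add_sqrt_log_le {v p s : ℝ} (hv : 0 < v) (hp : 0 < p) (hp1 : p ≤ 1)
    (hs : 0 ≤ s) :
    Real.exp (-(Real.sqrt (2 * v * Real.log (1 / p)) + s) ^ 2 / (2 * v)) ≤
      p * Real.exp (-(1 / (2 * v)) * s ^ 2) := by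
  have hlog : 0 ≤ Real.log (1 / p) := Real.log_nonneg (one_le_one_div hp hp1)
  have hsq := Real.sq_sqrt (mul_nonneg (mul_pos two_pos hv).le hlog)
  have ht := Real.sqrt_nonneg (2 * v * Real.log (1 / p))
  set t := Real.sqrt (2 * v * Real.log (1 / p))
  rw [one_div, Real.log_inv] at hsq
  nth_rewrite 1 [← Real.exp_log hp]
  rw [← Real.exp_add, Real.exp_le_exp, div_le_iff₀ (by positivity)]
  have h : (Real.log p + -(1 / (2 * v)) * s ^ 2) * (2 * v) = 2 * v * Real.log p - s ^ 2 := by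
    field_simp
    ring
  rw [h]
  nlinarith [mul_nonneg ht hs]

/-- If `P(X > s) ≤ exp(−s²/(2v))` for all `s > 0` and `E` is an event of positive
probability, then `E[1_E · max(X,0)] ≤ P(E)√(2v log(1/P(E))) + P(E)√(2πv)`, and the
same bound holds for `E[1_E · X]` whenever `1_E·X` is integrable. -/
theorem stmt_11 {Ω : Type*} [MeasurableSpace Ω] (μ : Measure Ω) [IsProbabilityMeasure μ]
    (v : ℝ) (hv : 0 < v) (X : Ω → ℝ) (hX : Measurable X)
    (htail : ∀ s : ℝ, 0 < s → μ {ω | s < X ω} ≤ ENNReal.ofReal (Real.exp (-s ^ 2 / (2 * v))))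
    (E : Set Ω) (hE : MeasurableSet E) (hEpos : 0 < μ E) :
    (∫ ω, E.indicator (fun ω => max (X ω) 0) ω ∂μ ≤
        (μ E).toReal * Real.sqrt (2 * v * Real.log (1 / (μ E).toReal)) +
          (μ E).toReal * Real.sqrt (2 * Real.pi * v)) ∧
    (Integrable (E.indicator X) μ →
      ∫ ω, E.indicator X ω ∂μ ≤
        (μ E).toReal * Real.sqrt (2 * v * Real.log (1 / (μ E).toReal)) +
          (μ E).toReal * Real.sqrt (2 * Real.pi * v)) := by
  have hp : 0 < (μ E).toReal := ENNReal.toReal_pos hEpos.ne' (measure_ne_top μ E)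
  have hp1 : (μ E).toReal ≤ 1 := ENNReal.toReal_le_of_le_ofReal zero_le_one (by simpa using prob_le_one)
  have ht := Real.sqrt_nonneg (2 * v * Real.log (1 / (μ E).toReal))
  have htail' : ∀ s : ℝ, 0 < s →
      μ {ω | s < X ω - Real.sqrt (2 * v * Real.log (1 / (μ E).toReal))} ≤
        ENNReal.ofReal ((μ E).toReal * Real.exp (-(1 / (2 * v)) * s ^ 2)) := by
    intro s hs
    simp only [lt_sub_iff_add_lt']
    exact (htail _ (by positivity)).trans
      (ENNReal.ofReal_le_ofReal (exp_neg_sq_add_sqrt_log_le hv hp hp1 hs.le))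
  set t := Real.sqrt (2 * v * Real.log (1 / (μ E).toReal))
  obtain ⟨hint, hle⟩ :=
    integrable_and_integral_posPart_le_of_gaussian_tail hv hp.le (hX.sub_const t) htail'
  have hconst : Integrable (E.indicator fun _ => t) μ := (integrable_const t).indicator hE
  have hbound : ∫ ω, (E.indicator (fun _ => t) ω + max (X ω - t) 0) ∂μ ≤
      (μ E).toReal * t + (μ E).toReal * Real.sqrt (2 * Real.pi * v) := by
    rw [integral_add hconst hint, integral_indicator_const t hE, smul_eq_mul, measureReal_def]
    gcongr
  have hpt : ∀ ω, E.indicator (fun ω => max (X ω) 0) ω ≤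
      E.indicator (fun _ => t) ω + max (X ω - t) 0 := by
    intro ω
    by_cases hω : ω ∈ E
    · simp only [Set.indicator_of_mem hω]
      refine max_le ?_ (by positivity)
      linarith [le_max_left (X ω - t) 0]
    · simp [hω]
  refine ⟨(integral_mono_of_nonneg (ae_of_all _ fun ω => ?_) (hconst.add hint)
    (ae_of_all _ hpt)).trans hbound, fun hXE => (integral_mono hXE (hconst.add hint)
    fun ω => le_trans ?_ (hpt ω)).trans hbound⟩
  · exact Set.indicator_nonneg (fun ω _ => le_max_right _ _) ω
  · exact Set.indicator_le_indicator (le_max_left _ _)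
end

section
/- For every v > 0 and every p ∈ (0,1]: ∫₀^∞ min{ p, exp(−s²/(2v)) } ds ≤ p·√( 2v·log(1/p) ) + p·√(2πv). -/
open MeasureTheory in
/-- For `v > 0` and `p ∈ (0,1]`:
`∫₀^∞ min{p, exp(−s²/(2v))} ds ≤ p√(2v log(1/p)) + p√(2πv)`. -/
theorem stmt_12 (v p : ℝ) (hv : 0 < v) (hp : p ∈ Set.Ioc (0 : ℝ) 1) :
    ∫ s in Set.Ioi (0 : ℝ), min p (Real.exp (-s ^ 2 / (2 * v))) ≤
      p * Real.sqrt (2 * v * Real.log (1 / p)) + p * Real.sqrt (2 * Real.pi * v) := by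
  obtain ⟨hp0, hp1⟩ := hp
  set T := Real.sqrt (2 * v * Real.log (1 / p)) with hT
  have hT0 : 0 ≤ T := Real.sqrt_nonneg _
  have hlog : 0 ≤ Real.log (1 / p) := Real.log_nonneg (by rw [le_div_iff₀ hp0]; linarith)
  have hT2 : T ^ 2 = 2 * v * Real.log (1 / p) := Real.sq_sqrt (by positivity)
  have hb : 0 < 1 / (2 * v) := by positivity
  have hgauss : Integrable (fun s : ℝ => p * Real.exp (-(1 / (2 * v)) * (s - T) ^ 2)) :=
    ((integrable_exp_neg_mul_sq hb).comp_sub_right T).const_mul p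
  have hind : Integrable ((Set.Ioc 0 T).indicator fun _ => p) :=
    (integrable_indicator_iff measurableSet_Ioc).2 (integrableOn_const (by simp))
  have hpoint : ∀ s ∈ Set.Ioi (0 : ℝ), min p (Real.exp (-s ^ 2 / (2 * v))) ≤
      (Set.Ioc 0 T).indicator (fun _ => p) s + p * Real.exp (-(1 / (2 * v)) * (s - T) ^ 2) := by
    intro s hs
    rcases le_or_gt s T with h | h
    · rw [Set.indicator_of_mem (show s ∈ Set.Ioc 0 T from ⟨hs, h⟩)]
      exact (min_le_left _ _).trans (le_add_of_nonneg_right (by positivity))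
    · rw [Set.indicator_of_notMem (fun hmem => h.not_ge hmem.2), zero_add]
      refine (min_le_right _ _).trans ?_
      have hpe : p = Real.exp (-(1 / (2 * v)) * T ^ 2) := by
        rw [hT2, one_div p, Real.log_inv]
        have : -(1 / (2 * v)) * (2 * v * -Real.log p) = Real.log p := by field_simp
        rw [this, Real.exp_log hp0]
      calc Real.exp (-s ^ 2 / (2 * v))
          ≤ Real.exp (-(1 / (2 * v)) * T ^ 2 + -(1 / (2 * v)) * (s - T) ^ 2) := by
            refine Real.exp_le_exp.2 ?_
            have hsq : T ^ 2 + (s - T) ^ 2 ≤ s ^ 2 := by nlinarith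
            have := mul_le_mul_of_nonneg_left hsq hb.le
            have h' : -s ^ 2 / (2 * v) = -(1 / (2 * v) * s ^ 2) := by ring
            rw [h']
            linarith
        _ = p * Real.exp (-(1 / (2 * v)) * (s - T) ^ 2) := by rw [Real.exp_add, ← hpe]
  have hnonneg : ∀ s, 0 ≤ (Set.Ioc 0 T).indicator (fun _ => p) s +
      p * Real.exp (-(1 / (2 * v)) * (s - T) ^ 2) := fun s =>
    add_nonneg (Set.indicator_nonneg (fun _ _ => hp0.le) s) (by positivity)
  calc ∫ s in Set.Ioi (0 : ℝ), min p (Real.exp (-s ^ 2 / (2 * v)))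
      ≤ ∫ s in Set.Ioi (0 : ℝ), ((Set.Ioc 0 T).indicator (fun _ => p) s +
          p * Real.exp (-(1 / (2 * v)) * (s - T) ^ 2)) :=
        integral_mono_of_nonneg (.of_forall fun s => le_min hp0.le (Real.exp_pos _).le)
          (hind.add hgauss).integrableOn
          ((ae_restrict_iff' measurableSet_Ioi).2 (.of_forall hpoint))
    _ ≤ ∫ s, ((Set.Ioc 0 T).indicator (fun _ => p) s +
          p * Real.exp (-(1 / (2 * v)) * (s - T) ^ 2)) :=
        setIntegral_le_integral (hind.add hgauss) (.of_forall hnonneg)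
    _ = p * T + p * Real.sqrt (2 * Real.pi * v) := by
        rw [integral_add hind hgauss, integral_indicator measurableSet_Ioc, setIntegral_const,
          integral_const_mul,
          integral_sub_right_eq_self (fun s : ℝ => Real.exp (-(1 / (2 * v)) * s ^ 2)) T,
          integral_gaussian, Real.volume_real_Ioc_of_le hT0, sub_zero, smul_eq_mul, mul_comm T,
          show Real.pi / (1 / (2 * v)) = 2 * Real.pi * v by field_simp]
end
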